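/- arXiv:1610.03002 — 5 statements merged into one kernel-verified Lean document; each statement's English description precedes it below -/
import Mathlib

section
/- Let θ ∈ [0, π/2] and let d₁, …, dₙ be nonzero complex numbers (viewed as 2D vectors) such that each dᵢ can be written dᵢ = |dᵢ|·exp(𝐢·φᵢ) with φᵢ ∈ [0, θ] (so the maximum angle between any pair of the vectors is at most θ). Then ∑_{i=1}^{n} |dᵢ| ≤ sec(θ/2) · |∑_{i=1}^{n} dᵢ|. -/
open Real Finset

/-- Cone inequality: if nonzero complex vectors `d i` all have phase angles in `[0, θ]`
with `θ ∈ [0, π/2]`, then the sum of their moduli is at most `sec (θ/2)` times the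
modulus of their sum. -/
theorem sum_abs_le_sec_half_mul_abs_sum
    (θ : ℝ) (hθ0 : 0 ≤ θ) (hθ : θ ≤ π / 2)
    (n : ℕ) (d : Fin n → ℂ) (φ : Fin n → ℝ)
    (hne : ∀ i, d i ≠ 0)
    (hrep : ∀ i, d i = (‖d i‖ : ℂ) * Complex.exp ((φ i : ℂ) * Complex.I))
    (hφ0 : ∀ i, 0 ≤ φ i) (hφθ : ∀ i, φ i ≤ θ) :
    ∑ i, ‖d i‖ ≤ (1 / Real.cos (θ / 2)) * ‖∑ i, d i‖ := by
  have hpi := Real.pi_pos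
  have hc : 0 < Real.cos (θ / 2) :=
    Real.cos_pos_of_mem_Ioo ⟨by linarith, by linarith⟩
  have key : ∀ i, ‖d i‖ * Real.cos (θ / 2)
      ≤ (d i * Complex.exp (((-(θ / 2) : ℝ) : ℂ) * Complex.I)).re := by
    intro i
    have h1 : d i * Complex.exp (((-(θ / 2) : ℝ) : ℂ) * Complex.I)
        = (‖d i‖ : ℂ) * Complex.exp (((φ i - θ / 2 : ℝ) : ℂ) * Complex.I) := by
      conv_lhs => rw [hrep i]
      rw [mul_assoc, ← Complex.exp_add]
      congr 2
      push_cast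
      ring
    rw [h1, Complex.re_ofReal_mul, Complex.exp_ofReal_mul_I_re]
    refine mul_le_mul_of_nonneg_left ?_ (norm_nonneg _)
    rw [← Real.cos_abs (φ i - θ / 2)]
    apply Real.cos_le_cos_of_nonneg_of_le_pi (abs_nonneg _) (by linarith)
    rw [abs_le]
    constructor <;> linarith [hφ0 i, hφθ i]
  rw [one_div, inv_mul_eq_div, le_div_iff₀ hc, Finset.sum_mul]
  calc ∑ i, ‖d i‖ * Real.cos (θ / 2)
      ≤ ∑ i, (d i * Complex.exp (((-(θ / 2) : ℝ) : ℂ) * Complex.I)).re :=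
        Finset.sum_le_sum fun i _ => key i
    _ = ((∑ i, d i) * Complex.exp (((-(θ / 2) : ℝ) : ℂ) * Complex.I)).re := by
        rw [Finset.sum_mul, Complex.re_sum]
    _ ≤ ‖(∑ i, d i) * Complex.exp (((-(θ / 2) : ℝ) : ℂ) * Complex.I)‖ :=
        Complex.re_le_norm _
    _ = ‖∑ i, d i‖ := by
        rw [norm_mul, Complex.norm_exp_ofReal_mul_I, mul_one]
end

section
/- Let θ ∈ [0, π/2] and let d₁, …, dₙ be nonzero complex numbers such that each dᵢ = |dᵢ|·exp(𝐢·φᵢ) with φᵢ ∈ [0, θ]. Then (∑_{i=1}^{n} |dᵢ|)² ≤ (2/(cos θ + 1)) · |∑_{i=1}^{n} dᵢ|². -/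
open Real Finset

/-- Squared form of the cone inequality: if nonzero complex vectors `d i` all have phase
angles in `[0, θ]` with `θ ∈ [0, π/2]`, then the square of the sum of their moduli is at
most `2 / (cos θ + 1)` times the squared modulus of their sum. -/
theorem sq_sum_abs_le_mul_sq_abs_sum
    (θ : ℝ) (hθ0 : 0 ≤ θ) (hθ : θ ≤ π / 2)
    (n : ℕ) (d : Fin n → ℂ) (φ : Fin n → ℝ)
    (hne : ∀ i, d i ≠ 0)
    (hrep : ∀ i, d i = (‖d i‖ : ℂ) * Complex.exp ((φ i : ℂ) * Complex.I))
    (hφ0 : ∀ i, 0 ≤ φ i) (hφθ : ∀ i, φ i ≤ θ) :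
    (∑ i, ‖d i‖) ^ 2 ≤
      (2 / (Real.cos θ + 1)) * ‖∑ i, d i‖ ^ 2 := by
  have hc : 0 ≤ Real.cos (θ / 2) :=
    Real.cos_nonneg_of_neg_pi_div_two_le_of_le (by linarith [Real.pi_pos]) (by linarith [Real.pi_pos])
  have hcθ : 0 ≤ Real.cos θ :=
    Real.cos_nonneg_of_neg_pi_div_two_le_of_le (by linarith [Real.pi_pos]) hθ
  have hsq : Real.cos (θ / 2) ^ 2 = (Real.cos θ + 1) / 2 := by
    rw [Real.cos_sq, show 2 * (θ / 2) = θ by ring]; ring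
  have hterm : ∀ i, Real.cos (θ / 2) * ‖d i‖ ≤
      (Complex.exp (((-(θ / 2) : ℝ) : ℂ) * Complex.I) * d i).re := by
    intro i
    have h1 : (Complex.exp (((-(θ / 2) : ℝ) : ℂ) * Complex.I) * d i).re
        = ‖d i‖ * Real.cos (φ i - θ / 2) := by
      have h2 : Complex.exp (((-(θ / 2) : ℝ) : ℂ) * Complex.I) * d i
          = (‖d i‖ : ℂ) * Complex.exp (((φ i - θ / 2 : ℝ) : ℂ) * Complex.I) := by
        conv_lhs => rw [hrep i]
        rw [mul_left_comm, ← Complex.exp_add]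
        congr 2
        push_cast
        ring
      rw [h2, Complex.re_ofReal_mul, Complex.exp_ofReal_mul_I_re]
    rw [h1, mul_comm]
    apply mul_le_mul_of_nonneg_left _ (norm_nonneg _)
    rw [← Real.cos_abs (φ i - θ / 2)]
    apply Real.cos_le_cos_of_nonneg_of_le_pi (abs_nonneg _) (by linarith [Real.pi_pos])
    rw [abs_le]
    constructor <;> linarith [hφ0 i, hφθ i]
  have hmain : Real.cos (θ / 2) * ∑ i, ‖d i‖ ≤ ‖∑ i, d i‖ := by
    calc Real.cos (θ / 2) * ∑ i, ‖d i‖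
        ≤ ∑ i, (Complex.exp (((-(θ / 2) : ℝ) : ℂ) * Complex.I) * d i).re := by
          rw [Finset.mul_sum]
          exact Finset.sum_le_sum fun i _ => hterm i
      _ = (Complex.exp (((-(θ / 2) : ℝ) : ℂ) * Complex.I) * ∑ i, d i).re := by
          rw [Finset.mul_sum, Complex.re_sum]
      _ ≤ ‖Complex.exp (((-(θ / 2) : ℝ) : ℂ) * Complex.I) * ∑ i, d i‖ := Complex.re_le_norm _
      _ = ‖∑ i, d i‖ := by rw [norm_mul, Complex.norm_exp_ofReal_mul_I, one_mul]
  have hS : 0 ≤ ∑ i, ‖d i‖ := Finset.sum_nonneg fun i _ => norm_nonneg _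
  have h3 := pow_le_pow_left₀ (mul_nonneg hc hS) hmain 2
  rw [mul_pow, hsq] at h3
  rw [div_mul_eq_mul_div, le_div_iff₀ (by linarith)]
  linarith
end

section
/- Let θ ∈ [0, π/2] and let d₁, d₂ be nonzero complex numbers with d₁ = |d₁|·exp(𝐢·φ₁), d₂ = |d₂|·exp(𝐢·φ₂) and |φ₁ − φ₂| ≤ θ. Then (|d₁| + |d₂|)² ≤ (2/(cos θ + 1)) · |d₁ + d₂|². -/
open Real

/-- Base case `n = 2` of the squared cone inequality: for two nonzero complex vectors
whose phase angles differ by at most `θ ∈ [0, π/2]`,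
`(|d₁| + |d₂|)² ≤ (2/(cos θ + 1)) · |d₁ + d₂|²`. -/
theorem sq_add_abs_le_mul_sq_abs_add
    (θ : ℝ) (hθ0 : 0 ≤ θ) (hθ : θ ≤ π / 2)
    (d₁ d₂ : ℂ) (φ₁ φ₂ : ℝ)
    (h₁ : d₁ ≠ 0) (h₂ : d₂ ≠ 0)
    (hrep₁ : d₁ = (‖d₁‖ : ℂ) * Complex.exp ((φ₁ : ℂ) * Complex.I))
    (hrep₂ : d₂ = (‖d₂‖ : ℂ) * Complex.exp ((φ₂ : ℂ) * Complex.I))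
    (hangle : |φ₁ - φ₂| ≤ θ) :
    (‖d₁‖ + ‖d₂‖) ^ 2 ≤
      (2 / (Real.cos θ + 1)) * ‖d₁ + d₂‖ ^ 2 := by
  have hc : Real.cos θ ≤ Real.cos (φ₁ - φ₂) := by
    rw [← Real.cos_abs (φ₁ - φ₂)]
    exact Real.cos_le_cos_of_nonneg_of_le_pi (abs_nonneg _) (by linarith [Real.pi_pos]) hangle
  have hc0 : 0 ≤ Real.cos θ :=
    Real.cos_nonneg_of_neg_pi_div_two_le_of_le (by linarith [Real.pi_pos]) hθ
  have ha := norm_nonneg d₁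
  have hb := norm_nonneg d₂
  have key : ‖d₁ + d₂‖ ^ 2 =
      ‖d₁‖ ^ 2 + ‖d₂‖ ^ 2 + 2 * (‖d₁‖ * ‖d₂‖) * Real.cos (φ₁ - φ₂) := by
    have r1 : d₁.re = ‖d₁‖ * Real.cos φ₁ := by
      have := congrArg Complex.re hrep₁
      rwa [Complex.re_ofReal_mul, Complex.exp_ofReal_mul_I_re] at this
    have i1 : d₁.im = ‖d₁‖ * Real.sin φ₁ := by
      have := congrArg Complex.im hrep₁
      rwa [Complex.im_ofReal_mul, Complex.exp_ofReal_mul_I_im] at this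
    have r2 : d₂.re = ‖d₂‖ * Real.cos φ₂ := by
      have := congrArg Complex.re hrep₂
      rwa [Complex.re_ofReal_mul, Complex.exp_ofReal_mul_I_re] at this
    have i2 : d₂.im = ‖d₂‖ * Real.sin φ₂ := by
      have := congrArg Complex.im hrep₂
      rwa [Complex.im_ofReal_mul, Complex.exp_ofReal_mul_I_im] at this
    rw [Complex.sq_norm (d₁ + d₂), Complex.normSq_apply, Complex.add_re, Complex.add_im,
      r1, i1, r2, i2, Real.cos_sub]
    linear_combination ‖d₁‖ ^ 2 * Real.sin_sq_add_cos_sq φ₁ + ‖d₂‖ ^ 2 * Real.sin_sq_add_cos_sq φ₂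
  rw [key, div_mul_eq_mul_div, le_div_iff₀ (by linarith)]
  have t1 := mul_nonneg (mul_nonneg ha hb) (sub_nonneg.2 hc)
  have t2 := mul_nonneg (sub_nonneg.2 (Real.cos_le_one θ)) (sq_nonneg (‖d₁‖ - ‖d₂‖))
  nlinarith [t1, t2]
end

section
/- Let θ ∈ [0, π/2], let C > 0, and let S₁, …, Sₙ be nonzero complex numbers such that each Sₖ = |Sₖ|·exp(𝐢·φₖ) with φₖ ∈ [0, θ]. Then for every subset X ⊆ {1, …, n} with |∑_{k ∈ X} Sₖ| ≤ C, one has cos(θ/2) · ∑_{k ∈ X} |Sₖ| ≤ C. In particular, assigning the fractional value xₖ = cos(θ/2) to each k ∈ X and xₖ = 0 otherwise yields a feasible solution of the linear relaxation ∑_{k} |Sₖ|·xₖ ≤ C with 0 ≤ xₖ ≤ 1. -/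
open Real Finset

/-- If all demands have phase angles in `[0, θ]` with `θ ∈ [0, π/2]`, then any feasible
set `X` (i.e. `|∑_{k∈X} Sₖ| ≤ C`) satisfies `cos(θ/2) · ∑_{k∈X} |Sₖ| ≤ C`; in
particular the fractional assignment `xₖ = cos(θ/2)` for `k ∈ X` and `xₖ = 0` otherwise
is feasible for the linear relaxation `∑ₖ |Sₖ|·xₖ ≤ C`, `0 ≤ xₖ ≤ 1`. -/
theorem feasible_scaled_fractional_solution
    (θ : ℝ) (hθ0 : 0 ≤ θ) (hθ : θ ≤ π / 2)
    (C : ℝ) (hC : 0 < C)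
    (n : ℕ) (S : Fin n → ℂ) (φ : Fin n → ℝ)
    (hne : ∀ k, S k ≠ 0)
    (hrep : ∀ k, S k = (‖S k‖ : ℂ) * Complex.exp ((φ k : ℂ) * Complex.I))
    (hφ0 : ∀ k, 0 ≤ φ k) (hφθ : ∀ k, φ k ≤ θ) :
    ∀ X : Finset (Fin n), ‖∑ k ∈ X, S k‖ ≤ C →
      Real.cos (θ / 2) * ∑ k ∈ X, ‖S k‖ ≤ C ∧
      (∀ k : Fin n, 0 ≤ (if k ∈ X then Real.cos (θ / 2) else 0) ∧
        (if k ∈ X then Real.cos (θ / 2) else 0) ≤ 1) ∧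
      ∑ k : Fin n, ‖S k‖ * (if k ∈ X then Real.cos (θ / 2) else 0) ≤ C := by
  intro X hX
  have hpi := Real.pi_pos
  have hc0 : 0 ≤ Real.cos (θ / 2) :=
    Real.cos_nonneg_of_neg_pi_div_two_le_of_le (by linarith) (by linarith)
  have key : ∀ k, Real.cos (θ / 2) * ‖S k‖ ≤
      (S k * Complex.exp (((-(θ / 2) : ℝ) : ℂ) * Complex.I)).re := by
    intro k
    have h1 : S k * Complex.exp (((-(θ / 2) : ℝ) : ℂ) * Complex.I)
        = (‖S k‖ : ℂ) * Complex.exp (((φ k - θ / 2 : ℝ) : ℂ) * Complex.I) := by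
      conv_lhs => rw [hrep k]
      rw [mul_assoc, ← Complex.exp_add]
      congr 2
      push_cast
      ring
    have h2 : Real.cos (θ / 2) ≤ Real.cos (φ k - θ / 2) := by
      rw [← Real.cos_abs (φ k - θ / 2)]
      apply Real.cos_le_cos_of_nonneg_of_le_pi (abs_nonneg _) (by linarith)
      rw [abs_le]
      constructor <;> linarith [hφ0 k, hφθ k]
    rw [h1, Complex.re_ofReal_mul, Complex.exp_ofReal_mul_I_re, mul_comm]
    exact mul_le_mul_of_nonneg_left h2 (norm_nonneg _)
  have main : Real.cos (θ / 2) * ∑ k ∈ X, ‖S k‖ ≤ C := by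
    calc Real.cos (θ / 2) * ∑ k ∈ X, ‖S k‖
        = ∑ k ∈ X, Real.cos (θ / 2) * ‖S k‖ := Finset.mul_sum _ _ _
      _ ≤ ∑ k ∈ X, (S k * Complex.exp (((-(θ / 2) : ℝ) : ℂ) * Complex.I)).re :=
          Finset.sum_le_sum fun k _ => key k
      _ = ((∑ k ∈ X, S k) * Complex.exp (((-(θ / 2) : ℝ) : ℂ) * Complex.I)).re := by
          rw [Finset.sum_mul, Complex.re_sum]
      _ ≤ ‖(∑ k ∈ X, S k) * Complex.exp (((-(θ / 2) : ℝ) : ℂ) * Complex.I)‖ :=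
          Complex.re_le_norm _
      _ = ‖∑ k ∈ X, S k‖ := by
          rw [norm_mul, Complex.norm_exp_ofReal_mul_I, mul_one]
      _ ≤ C := hX
  refine ⟨main, ?_, ?_⟩
  · intro k
    split_ifs
    · exact ⟨hc0, Real.cos_le_one _⟩
    · exact ⟨le_rfl, zero_le_one⟩
  · have h : ∑ k : Fin n, ‖S k‖ * (if k ∈ X then Real.cos (θ / 2) else 0)
        = Real.cos (θ / 2) * ∑ k ∈ X, ‖S k‖ := by
      simp only [mul_ite, mul_zero, Finset.sum_ite_mem, Finset.univ_inter]
      rw [← Finset.sum_mul, mul_comm]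
    rw [h]
    exact main
end

section
/- Let θ ∈ [0, π/2] and C > 0. Let S₁, …, Sₙ be nonzero complex demands with |Sₖ| ≤ C for all k, such that each Sₖ = |Sₖ|·exp(𝐢·φₖ) with φₖ ∈ [0, θ], and let u₁, …, uₙ > 0 be utilities sorted so that u₁/|S₁| ≥ u₂/|S₂| ≥ … ≥ uₙ/|Sₙ|. Suppose t ∈ {1, …, n} satisfies ∑_{k=1}^{t−1} |Sₖ| ≤ C and ∑_{k=1}^{t} |Sₖ| > C. Then max( ∑_{k=1}^{t−1} uₖ , max_{1 ≤ k ≤ n} uₖ ) ≥ (1/2)·cos(θ/2) · ∑_{k ∈ X} uₖ for every subset X ⊆ {1, …, n} with |∑_{k ∈ X} Sₖ| ≤ C. -/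
open Real Finset

/-- Worst-case guarantee of the Greedy Ratio Algorithm for the UMDR problem: the better
of the greedy prefix value and the single highest utility is at least
`(1/2)·cos(θ/2)` times the value of any feasible set. -/
theorem GRA_worst_case_guarantee
    (θ : ℝ) (hθ0 : 0 ≤ θ) (hθ : θ ≤ π / 2)
    (C : ℝ) (hC : 0 < C)
    (n : ℕ) (S : Fin n → ℂ) (φ : Fin n → ℝ) (u : Fin n → ℝ)
    (hne : ∀ k, S k ≠ 0)
    (hSC : ∀ k, ‖S k‖ ≤ C)
    (hrep : ∀ k, S k = (‖S k‖ : ℂ) * Complex.exp ((φ k : ℂ) * Complex.I))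
    (hφ0 : ∀ k, 0 ≤ φ k) (hφθ : ∀ k, φ k ≤ θ)
    (hu : ∀ k, 0 < u k)
    (hsorted : ∀ i j : Fin n, i ≤ j →
      u j / ‖S j‖ ≤ u i / ‖S i‖)
    (t : Fin n)
    (ht1 : ∑ k ∈ Finset.Iio t, ‖S k‖ ≤ C)
    (ht2 : C < ∑ k ∈ Finset.Iic t, ‖S k‖) :
    ∀ X : Finset (Fin n), ‖∑ k ∈ X, S k‖ ≤ C →
      (1 / 2) * Real.cos (θ / 2) * ∑ k ∈ X, u k ≤
        max (∑ k ∈ Finset.Iio t, u k) (Finset.univ.sup' ⟨t, Finset.mem_univ t⟩ u) := by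
  intro X hX
  have hpos : ∀ k, 0 < ‖S k‖ := fun k => norm_pos_iff.mpr (hne k)
  have hc1 : Real.cos (θ / 2) ≤ 1 := Real.cos_le_one _
  have hc0 : 0 ≤ Real.cos (θ / 2) :=
    Real.cos_nonneg_of_neg_pi_div_two_le_of_le (by linarith [Real.pi_pos]) (by linarith [Real.pi_pos])
  -- projection on the bisecting direction
  have hproj : Real.cos (θ / 2) * ∑ k ∈ X, ‖S k‖ ≤ C := by
    have hre : ∀ k, Real.cos (θ / 2) * ‖S k‖ ≤
        (Complex.exp (((-(θ / 2) : ℝ) : ℂ) * Complex.I) * S k).re := by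
      intro k
      have h1 : Complex.exp (((-(θ / 2) : ℝ) : ℂ) * Complex.I) * S k
          = (‖S k‖ : ℂ) * Complex.exp (((φ k - θ / 2 : ℝ) : ℂ) * Complex.I) := by
        conv_lhs => rw [hrep k]
        rw [mul_left_comm, ← Complex.exp_add]
        congr 2
        push_cast
        ring
      rw [h1, Complex.re_ofReal_mul, Complex.exp_ofReal_mul_I_re, mul_comm]
      apply mul_le_mul_of_nonneg_left _ (hpos k).le
      rw [← Real.cos_abs (φ k - θ / 2)]
      apply Real.cos_le_cos_of_nonneg_of_le_pi (abs_nonneg _) (by linarith [Real.pi_pos])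
      rw [abs_le]
      constructor <;> linarith [hφ0 k, hφθ k]
    calc Real.cos (θ / 2) * ∑ k ∈ X, ‖S k‖
        = ∑ k ∈ X, Real.cos (θ / 2) * ‖S k‖ := Finset.mul_sum _ _ _
      _ ≤ ∑ k ∈ X, (Complex.exp (((-(θ / 2) : ℝ) : ℂ) * Complex.I) * S k).re :=
          Finset.sum_le_sum fun k _ => hre k
      _ = (Complex.exp (((-(θ / 2) : ℝ) : ℂ) * Complex.I) * ∑ k ∈ X, S k).re := by
          rw [Finset.mul_sum, Complex.re_sum]
      _ ≤ ‖Complex.exp (((-(θ / 2) : ℝ) : ℂ) * Complex.I) * ∑ k ∈ X, S k‖ :=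
          Complex.re_le_norm _
      _ ≤ C := by rw [norm_mul, Complex.norm_exp_ofReal_mul_I, one_mul]; exact hX
  obtain ⟨r, hr⟩ : ∃ r, r = u t / ‖S t‖ := ⟨_, rfl⟩
  have hr0 : 0 < r := hr ▸ div_pos (hu t) (hpos t)
  have hle : ∀ k, k ≤ t → 0 ≤ u k - r * ‖S k‖ := by
    intro k hk
    have := hsorted k t hk
    rw [← hr, le_div_iff₀ (hpos k)] at this
    linarith
  have hge : ∀ k, t ≤ k → u k - r * ‖S k‖ ≤ 0 := by
    intro k hk
    have := hsorted t k hk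
    rw [← hr, div_le_iff₀ (hpos k)] at this
    linarith
  have hkey : ∑ k ∈ X, (u k - r * ‖S k‖) ≤ ∑ k ∈ Finset.Iic t, (u k - r * ‖S k‖) := by
    calc ∑ k ∈ X, (u k - r * ‖S k‖)
        ≤ ∑ k ∈ X, (if k ∈ Finset.Iic t then u k - r * ‖S k‖ else 0) := by
          apply Finset.sum_le_sum
          intro k _
          split_ifs with h
          · exact le_rfl
          · exact hge k (le_of_lt (by simpa using h))
      _ ≤ ∑ k, (if k ∈ Finset.Iic t then u k - r * ‖S k‖ else 0) := by
          apply Finset.sum_le_sum_of_subset_of_nonneg (Finset.subset_univ _)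
          intro k _ _
          split_ifs with h
          · exact hle k (by simpa using h)
          · exact le_rfl
      _ = ∑ k ∈ Finset.Iic t, (u k - r * ‖S k‖) := by
          rw [Finset.sum_ite_mem, Finset.univ_inter]
  have hP : 0 ≤ ∑ k ∈ Finset.Iic t, (u k - r * ‖S k‖) :=
    Finset.sum_nonneg fun k hk => hle k (by simpa using hk)
  simp only [Finset.sum_sub_distrib, ← Finset.mul_sum] at hkey hP
  have hsplit : ∑ k ∈ Finset.Iic t, u k = ∑ k ∈ Finset.Iio t, u k + u t := by
    rw [← Finset.Iio_insert, Finset.sum_insert (by simp), add_comm]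
  have hm1 := le_max_left (∑ k ∈ Finset.Iio t, u k) (Finset.univ.sup' ⟨t, Finset.mem_univ t⟩ u)
  have hm2 := (Finset.le_sup' u (Finset.mem_univ t)).trans
    (le_max_right (∑ k ∈ Finset.Iio t, u k) (Finset.univ.sup' ⟨t, Finset.mem_univ t⟩ u))
  have e1 := mul_le_mul_of_nonneg_left hkey hc0
  have e2 := mul_nonneg (sub_nonneg.mpr hc1) hP
  have e3 := mul_le_mul_of_nonneg_left hproj hr0.le
  have e4 := mul_le_mul_of_nonneg_left ht2.le hr0.le
  have hfin : Real.cos (θ / 2) * ∑ k ∈ X, u k ≤ ∑ k ∈ Finset.Iic t, u k := by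
    linarith
  linarith
end
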